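/- There is a universal constant C₅ > 1 such that the following holds. Let R, K > 0, let ℓ, m ∈ ℤ₊ with ℓ ≤ m/10, and let a ∈ Λ. Suppose u : P_{a;m,ℓ} → ℝ satisfies: (1) |u(b) + u(b-ξ) + u(b+η)| ≤ R for every b ∈ P_{a-η;m,ℓ-1}; (2) |u| ≤ K on the upper edge of P_{a;m,ℓ}; (3) |u(b)| ≤ K for at least half of the points b of the lower edge of P_{a;m,ℓ}. Then |u| ≤ C₅^{ℓ+m}·(K+R) on P_{a;m,ℓ}. -/

import Mathlib

/-- The lattice vector `ξ = (-1, 0)` of the triangular lattice in `ℝ²`. -/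
noncomputable def xiv : ℝ × ℝ := (-1, 0)

/-- The lattice vector `η = (1/2, √3/2)` of the triangular lattice in `ℝ²`. -/
noncomputable def etav : ℝ × ℝ := (1 / 2, Real.sqrt 3 / 2)

/-- The triangular lattice `Λ = {sξ + tη : s, t ∈ ℤ}`. -/
def Lam : Set (ℝ × ℝ) := {p | ∃ s t : ℤ, p = (s : ℝ) • xiv + (t : ℝ) • etav}

/-- The trapezoid `P_{a;m,ℓ} = {a + sξ + tη : -ℓ ≤ t ≤ 0, -m+t ≤ s ≤ 0}`. -/
def Pset (a : ℝ × ℝ) (m l : ℕ) : Set (ℝ × ℝ) :=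
  {p | ∃ s t : ℤ, -(l : ℤ) ≤ t ∧ t ≤ 0 ∧ -(m : ℤ) + t ≤ s ∧ s ≤ 0 ∧
    p = a + (s : ℝ) • xiv + (t : ℝ) • etav}

/-- A finite set of positive integers has product at least the factorial of its cardinality. -/
lemma factorial_card_le_prod_id (T : Finset ℕ) (hT : 0 ∉ T) :
    T.card.factorial ≤ ∏ j ∈ T, j := by
  induction T using Finset.induction_on_max with
  | empty => simp
  | insert n s hs ih =>
    have hn : n ∉ s := fun h => lt_irrefl _ (hs n h)
    have hcard : s.card + 1 ≤ n := by
      have hsub : s ⊆ Finset.Ico 1 n := fun j hj => by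
        have : j ≠ 0 := fun h => hT (by simp [← h, hj])
        simp only [Finset.mem_Ico]
        exact ⟨by omega, hs j hj⟩
      have hle := Finset.card_le_card hsub
      have : n ≠ 0 := fun h => hT (by simp [h])
      simp only [Nat.card_Ico] at hle
      omega
    rw [Finset.card_insert_of_notMem hn, Finset.prod_insert hn, Nat.factorial_succ]
    exact Nat.mul_le_mul hcard (ih fun h => hT (by simp [h]))

lemma prod_div_le_exp {A : ℝ} (hA : 0 ≤ A) (T : Finset ℕ) (hT : 0 ∉ T) :
    ∏ j ∈ T, A / (j : ℝ) ≤ Real.exp A := by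
  rw [Finset.prod_div_distrib, Finset.prod_const]
  refine le_trans ?_ (Real.pow_div_factorial_le_exp A hA T.card)
  have hfac : (T.card.factorial : ℝ) ≤ ∏ j ∈ T, (j : ℝ) := by
    rw [← Nat.cast_prod]
    exact_mod_cast factorial_card_le_prod_id T hT
  have : (0 : ℝ) < T.card.factorial := by positivity
  gcongr

/-- Lagrange basis polynomials at integer nodes grow at most exponentially. -/
lemma abs_lagrange_basis_le {N : ℕ} {S : Finset ℕ} (hS : ∀ j ∈ S, j ≤ N) (i x : ℕ)
    (hx : x ≤ N) :
    |(Lagrange.basis S (fun j : ℕ => (j : ℝ)) i).eval (x : ℝ)| ≤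
      Real.exp N * Real.exp N := by
  have hfactor : ∀ j ∈ S.erase i,
      |((Lagrange.basisDivisor (i : ℝ) (j : ℝ)).eval (x : ℝ))| ≤ N / |(i : ℝ) - j| := by
    intro j hj
    have hjN : j ≤ N := hS j (Finset.mem_of_mem_erase hj)
    have hxj : |(x : ℝ) - j| ≤ N := by
      have h1 : (x : ℝ) ≤ N := by exact_mod_cast hx
      have h2 : (j : ℝ) ≤ N := by exact_mod_cast hjN
      have h3 : (0 : ℝ) ≤ x := by positivity
      have h4 : (0 : ℝ) ≤ j := by positivity
      rw [abs_le]
      constructor <;> linarith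
    simp only [Lagrange.basisDivisor, Polynomial.eval_mul, Polynomial.eval_C,
      Polynomial.eval_sub, Polynomial.eval_X, abs_mul, abs_inv]
    rw [div_eq_inv_mul]
    gcongr
  rw [Lagrange.basis, Polynomial.eval_prod, Finset.abs_prod]
  refine (Finset.prod_le_prod (fun _ _ => abs_nonneg _) hfactor).trans ?_
  rw [← Finset.prod_filter_mul_prod_filter_not (S.erase i) (fun j => j < i)]
  have hN : (0 : ℝ) ≤ N := by positivity
  refine mul_le_mul ?_ ?_ (Finset.prod_nonneg fun _ _ => by positivity) (Real.exp_pos _).le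
  · have hinj : Set.InjOn (fun j => i - j) ((S.erase i).filter (fun j => j < i)) := by
      intro p hp q hq hpq
      simp only [Finset.coe_filter, Set.mem_ofPred_eq] at hp hq hpq
      omega
    refine le_trans (le_of_eq ?_) (prod_div_le_exp hN
      (((S.erase i).filter (fun j => j < i)).image (fun j => i - j)) ?_)
    · rw [Finset.prod_image hinj]
      refine Finset.prod_congr rfl fun j hj => ?_
      have hlt : j < i := (Finset.mem_filter.1 hj).2
      rw [Nat.cast_sub hlt.le, abs_of_nonneg (sub_nonneg.2 (by exact_mod_cast hlt.le))]
    · simp only [Finset.mem_image, Finset.mem_filter, not_exists, not_and]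
      intro j hj
      omega
  · have hinj : Set.InjOn (fun j => j - i) ((S.erase i).filter (fun j => ¬ j < i)) := by
      intro p hp q hq hpq
      simp only [Finset.coe_filter, Set.mem_ofPred_eq] at hp hq hpq
      omega
    refine le_trans (le_of_eq ?_) (prod_div_le_exp hN
      (((S.erase i).filter (fun j => ¬ j < i)).image (fun j => j - i)) ?_)
    · rw [Finset.prod_image hinj]
      refine Finset.prod_congr rfl fun j hj => ?_
      have hle : i ≤ j := not_lt.1 (Finset.mem_filter.1 hj).2
      rw [Nat.cast_sub hle, abs_sub_comm, abs_of_nonneg (sub_nonneg.2 (by exact_mod_cast hle))]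
    · simp only [Finset.mem_image, Finset.mem_filter, Finset.mem_erase, not_exists, not_and]
      intro j hj
      omega

/-- A real polynomial of degree less than `S.card` that is bounded on the integer nodes `S` is
bounded at all integers in `[0, N]`, up to an exponential factor. -/
lemma abs_eval_le_of_abs_eval_nodes_le {N : ℕ} {S : Finset ℕ} (hS : ∀ j ∈ S, j ≤ N)
    {P : Polynomial ℝ} (hP : P.degree < S.card) {M : ℝ}
    (hM : ∀ i ∈ S, |P.eval (i : ℝ)| ≤ M) (x : ℕ) (hx : x ≤ N) :
    |P.eval (x : ℝ)| ≤ S.card * (M * (Real.exp N * Real.exp N)) := by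
  have hinj : Set.InjOn (fun j : ℕ => (j : ℝ)) S := Nat.cast_injective.injOn
  rw [Lagrange.eq_interpolate hinj hP, Lagrange.interpolate_apply, Polynomial.eval_finsetSum]
  refine (Finset.abs_sum_le_sum_abs _ _).trans ?_
  rw [← nsmul_eq_mul]
  refine Finset.sum_le_card_nsmul _ _ _ fun i hi => ?_
  rw [Polynomial.eval_mul, Polynomial.eval_C, abs_mul]
  exact mul_le_mul (hM i hi) (abs_lagrange_basis_le hS i x hx) (abs_nonneg _)
    ((abs_nonneg _).trans (hM i hi))

/-- A combination of the first `l` binomial coefficients is a polynomial of degree less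
than `l`. -/
lemma exists_polynomial_eval_eq_sum_choose (l : ℕ) (c : ℕ → ℝ) :
    ∃ P : Polynomial ℝ, P.degree < l ∧
      ∀ x : ℕ, P.eval (x : ℝ) = ∑ j ∈ Finset.range l, c j * (x.choose j : ℝ) := by
  refine ⟨∑ j ∈ Finset.range l,
    Polynomial.C (c j / (j.factorial : ℝ)) * descPochhammer ℝ j, ?_, fun x => ?_⟩
  · rw [← Polynomial.mem_degreeLT]
    refine Submodule.sum_mem _ fun j hj => ?_
    rw [← Polynomial.smul_eq_C_mul]
    refine Submodule.smul_mem _ _ ?_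
    rw [Polynomial.mem_degreeLT, Polynomial.degree_eq_natDegree (monic_descPochhammer ℝ j).ne_zero,
      descPochhammer_natDegree]
    exact_mod_cast Finset.mem_range.1 hj
  · rw [Polynomial.eval_finsetSum]
    refine Finset.sum_congr rfl fun j _ => ?_
    rw [Polynomial.eval_mul, Polynomial.eval_C, descPochhammer_eval_eq_descFactorial,
      Nat.descFactorial_eq_factorial_mul_choose]
    have : (j.factorial : ℝ) ≠ 0 := by positivity
    push_cast
    field_simp

/-- If the difference of each row is approximately the preceding row, and row `0` is small, then
row `y` is approximately a combination of the first `y` binomial coefficients. -/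
lemma exists_row_approx_choose {R K : ℝ} (hR : 0 ≤ R) (hK : 0 ≤ K) {m l : ℕ} {h : ℕ → ℕ → ℝ}
    (hrec : ∀ y < l, ∀ x ≤ m + y, |h x (y + 1) - h (x + 1) (y + 1) + h x y| ≤ R)
    (hzero : ∀ x ≤ m, |h x 0| ≤ K) (y : ℕ) (hy : y ≤ l) :
    ∃ c : ℕ → ℝ, ∀ x ≤ m + y,
      |h x y - ∑ j ∈ Finset.range y, c j * (x.choose j : ℝ)| ≤ 2 ^ x * (K + R) - R := by
  induction y with
  | zero =>
    refine ⟨0, fun x hx => ?_⟩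
    have h1 : (1 : ℝ) ≤ 2 ^ x := one_le_pow₀ (by norm_num)
    have h2 := hzero x hx
    simp only [Finset.range_zero, Finset.sum_empty, sub_zero]
    nlinarith
  | succ y ih =>
    obtain ⟨c, hc⟩ := ih (by omega)
    refine ⟨fun j => Nat.casesOn j (h 0 (y + 1)) c, fun x hx => ?_⟩
    induction x with
    | zero => simpa [Finset.sum_range_succ'] using hK
    | succ x ihx =>
      have h1 := ihx (by omega)
      have h2 := hc x (by omega)
      have h3 := hrec y (by omega) x (by omega)
      simp only [Finset.sum_range_succ', Nat.choose_zero_right, Nat.cast_one, mul_one,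
        Nat.choose_succ_succ, Nat.cast_add, mul_add, Finset.sum_add_distrib] at h1 ⊢
      rw [pow_succ]
      rw [abs_le] at *
      constructor <;> linarith [h1.1, h1.2, h2.1, h2.2, h3.1, h3.2]

lemma abs_le_of_abs_lower_row_le {R B : ℝ} {m l : ℕ} {h : ℕ → ℕ → ℝ}
    (hrec : ∀ y < l, ∀ x ≤ m + y, |h x (y + 1) - h (x + 1) (y + 1) + h x y| ≤ R)
    (hlow : ∀ x ≤ m + l, |h x l| ≤ B) (k : ℕ) :
    ∀ y, y + k = l → ∀ x ≤ m + y, |h x y| ≤ 2 ^ k * (B + R) - R := by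
  induction k with
  | zero =>
    rintro y rfl x hx
    simpa using hlow x hx
  | succ k ih =>
    intro y hy x hx
    have h1 := ih (y + 1) (by omega) x (by omega)
    have h2 := ih (y + 1) (by omega) (x + 1) (by omega)
    have h3 := hrec y (by omega) x hx
    rw [pow_succ]
    rw [abs_le] at *
    constructor <;> linarith [h1.1, h1.2, h2.1, h2.2, h3.1, h3.2]

lemma abs_le_of_row_recurrence {R K : ℝ} (hR : 0 < R) (hK : 0 < K) {m l : ℕ} (hl : 0 < l)
    {h : ℕ → ℕ → ℝ}
    (hrec : ∀ y < l, ∀ x ≤ m + y, |h x (y + 1) - h (x + 1) (y + 1) + h x y| ≤ R)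
    (hzero : ∀ x ≤ m, |h x 0| ≤ K) {S : Finset ℕ} (hS : ∀ x ∈ S, x ≤ m + l ∧ |h x l| ≤ K)
    (hcard : S.card = l) (x y : ℕ) (hy : y ≤ l) (hx : x ≤ m + y) :
    |h x y| ≤ (32 * Real.exp 1 * Real.exp 1) ^ (l + m) * (K + R) := by
  obtain ⟨c, hc⟩ := exists_row_approx_choose hR.le hK.le hrec hzero l le_rfl
  obtain ⟨P, hdeg, hP⟩ := exists_polynomial_eval_eq_sum_choose l c
  simp only [← hP] at hc
  set N := m + l with hN
  set E := Real.exp N with hE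
  have hE1 : 1 ≤ E := Real.one_le_exp (by positivity)
  have hEpow : Real.exp 1 ^ N = E := by rw [hE, ← Real.exp_nat_mul, mul_one]
  have hpow : ∀ z ≤ N, (2 : ℝ) ^ z * (K + R) ≤ 2 ^ N * (K + R) := fun z hz => by
    gcongr
    norm_num
  have htwo : (2 : ℝ) ≤ 2 ^ N := le_self_pow₀ (by norm_num) (by omega)
  have hnodes : ∀ i ∈ S, |P.eval (i : ℝ)| ≤ 2 * 2 ^ N * (K + R) := fun i hi => by
    have h1 := hc i (hS i hi).1
    have h2 := (hS i hi).2
    have h3 := hpow i (hS i hi).1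
    have h4 : K ≤ 2 ^ N * (K + R) := by nlinarith
    rw [abs_le] at *
    constructor <;> linarith [h1.1, h1.2, h2.1, h2.2]
  have hlN : (l : ℝ) ≤ 2 ^ N := by
    have h1 : l ≤ 2 ^ N := (Nat.le_add_left l m).trans Nat.lt_two_pow_self.le
    exact_mod_cast h1
  have hKR : 0 < K + R := by positivity
  set D : ℝ := 2 ^ N with hD
  have hlow : ∀ z ≤ N, |h z l| ≤ 3 * (D ^ 2 * E ^ 2) * (K + R) - R := fun z hz => by
    have h1 := abs_eval_le_of_abs_eval_nodes_le (fun i hi => (hS i hi).1)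
      (by rwa [hcard]) hnodes z hz
    rw [hcard] at h1
    have h2 : (l : ℝ) * (2 * D * (K + R) * (E * E)) ≤ D * (2 * D * (K + R) * (E * E)) := by
      gcongr
    have h3 := hc z hz
    have h4 := hpow z hz
    have h5 : D * (K + R) ≤ D ^ 2 * E ^ 2 * (K + R) := by
      have h6 : D ≤ D ^ 2 := le_self_pow₀ (by linarith) (by norm_num)
      have h7 : 1 ≤ E ^ 2 := one_le_pow₀ hE1
      have h8 : D ≤ D ^ 2 * E ^ 2 := by nlinarith
      gcongr
    rw [abs_le] at *
    constructor <;> nlinarith [h1.1, h1.2, h3.1, h3.2]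
  have hfinal := abs_le_of_abs_lower_row_le hrec hlow (l - y) y (by omega) x hx
  rw [sub_add_cancel] at hfinal
  have hly : (2 : ℝ) ^ (l - y) ≤ D := pow_le_pow_right₀ (by norm_num) (by omega)
  have h3D : 3 ≤ D ^ 2 := by nlinarith
  have hC : (32 * Real.exp 1 * Real.exp 1) ^ (l + m) = D ^ 5 * E ^ 2 := by
    rw [add_comm l m, ← hN, mul_pow, mul_pow, hEpow, hD, ← pow_mul, mul_comm N 5, pow_mul]
    norm_num
    ring
  rw [hC]
  calc |h x y| ≤ 2 ^ (l - y) * (3 * (D ^ 2 * E ^ 2) * (K + R)) := by linarith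
    _ ≤ D * (D ^ 2 * (D ^ 2 * E ^ 2) * (K + R)) := by gcongr
    _ = D ^ 5 * E ^ 2 * (K + R) := by ring

lemma mem_Pset_iff {a p : ℝ × ℝ} {m l : ℕ} :
    p ∈ Pset a m l ↔
      ∃ x y : ℕ, y ≤ l ∧ x ≤ m + y ∧ p = a - (x : ℝ) • xiv - (y : ℝ) • etav := by
  constructor
  · rintro ⟨s, t, ht, ht0, hs, hs0, rfl⟩
    obtain ⟨x, rfl⟩ : ∃ x : ℕ, s = -(x : ℤ) := ⟨(-s).toNat, by omega⟩
    obtain ⟨y, rfl⟩ : ∃ y : ℕ, t = -(y : ℤ) := ⟨(-t).toNat, by omega⟩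
    refine ⟨x, y, by omega, by omega, ?_⟩
    push_cast
    module
  · rintro ⟨x, y, hy, hx, rfl⟩
    refine ⟨-x, -y, by omega, by omega, by omega, by omega, ?_⟩
    push_cast
    module

lemma sub_smul_xiv_injective (p : ℝ × ℝ) :
    Function.Injective fun x : ℕ => p - (x : ℝ) • xiv := by
  intro x y hxy
  simpa [xiv] using hxy

lemma ncard_lower_edge_sep (p : ℝ × ℝ) (n : ℕ) (q : ℝ × ℝ → Prop) [DecidablePred q] :
    {b | b ∈ Pset p n 0 ∧ q b}.ncard =
      ((Finset.range (n + 1)).filter fun x : ℕ => q (p - (x : ℝ) • xiv)).card := by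
  rw [← Finset.card_image_of_injective _ (sub_smul_xiv_injective p), ← Set.ncard_coe_finset]
  congr 1
  ext b
  simp only [Set.mem_ofPred_eq, mem_Pset_iff, Finset.coe_image, Finset.coe_filter,
    Finset.mem_range, Set.mem_image]
  constructor
  · rintro ⟨⟨x, y, hy, hx, rfl⟩, hq⟩
    obtain rfl : y = 0 := by omega
    simp only [Nat.cast_zero, zero_smul, sub_zero] at hq ⊢
    exact ⟨x, ⟨by omega, hq⟩, rfl⟩
  · rintro ⟨x, ⟨hx, hq⟩, rfl⟩
    exact ⟨⟨x, 0, le_rfl, by omega, by simp⟩, hq⟩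

/-- Bound on a trapezoid from smallness on the upper edge and half of the lower edge. -/
theorem trapezoid_bound :
    ∃ C₅ : ℝ, 1 < C₅ ∧
      ∀ R K : ℝ, 0 < R → 0 < K →
        ∀ l m : ℕ, 0 < l → 0 < m → (l : ℝ) ≤ (m : ℝ) / 10 →
          ∀ a : ℝ × ℝ, a ∈ Lam →
            ∀ u : ℝ × ℝ → ℝ,
              (∀ b ∈ Pset (a - etav) m (l - 1),
                |u b + u (b - xiv) + u (b + etav)| ≤ R) →
              (∀ b ∈ Pset a m 0, |u b| ≤ K) →
              ((Pset (a - (l : ℝ) • etav) (m + l) 0).ncard ≤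
                2 * ({b | b ∈ Pset (a - (l : ℝ) • etav) (m + l) 0 ∧ |u b| ≤ K}).ncard) →
              ∀ b ∈ Pset a m l, |u b| ≤ C₅ ^ (l + m) * (K + R) := by
  classical
  refine ⟨32 * Real.exp 1 * Real.exp 1, ?_, ?_⟩
  · nlinarith [Real.one_le_exp zero_le_one]
  intro R K hR hK l m hl _ hlm a _ u hrec hup hlow b hb
  obtain ⟨x, y, hy, hx, rfl⟩ := mem_Pset_iff.1 hb
  have hlm' : 10 * l ≤ m := by
    have : (10 : ℝ) * l ≤ m := by linarith
    exact_mod_cast this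
  have htotal : (Pset (a - (l : ℝ) • etav) (m + l) 0).ncard = m + l + 1 := by
    simpa using ncard_lower_edge_sep (a - (l : ℝ) • etav) (m + l) fun _ => True
  rw [htotal, ncard_lower_edge_sep _ _ fun b => |u b| ≤ K] at hlow
  obtain ⟨S, hS, hcard⟩ := Finset.exists_subset_card_eq (n := l) (by omega :
    l ≤ ((Finset.range (m + l + 1)).filter
      fun x : ℕ => |u (a - (l : ℝ) • etav - (x : ℝ) • xiv)| ≤ K).card)
  have habs : ∀ (x : ℕ) (r : ℝ), |(-1) ^ x * r| = |r| := fun x r => by simp [abs_mul]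
  rw [← habs x]
  refine abs_le_of_row_recurrence (S := S) hR hK hl
    (h := fun x y => (-1) ^ x * u (a - (x : ℝ) • xiv - (y : ℝ) • etav)) ?_ ?_ ?_ hcard x y hy hx
  · intro y hy x hx
    have h1 := hrec (a - etav - (x : ℝ) • xiv - (y : ℝ) • etav)
      (mem_Pset_iff.2 ⟨x, y, by omega, hx, rfl⟩)
    rw [← habs x] at h1
    convert h1 using 2
    have e1 : a - (x : ℝ) • xiv - ((y + 1 : ℕ) : ℝ) • etav =
        a - etav - (x : ℝ) • xiv - (y : ℝ) • etav := by push_cast; module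
    have e2 : a - ((x + 1 : ℕ) : ℝ) • xiv - ((y + 1 : ℕ) : ℝ) • etav =
        a - etav - (x : ℝ) • xiv - (y : ℝ) • etav - xiv := by push_cast; module
    have e3 : a - (x : ℝ) • xiv - (y : ℝ) • etav =
        a - etav - (x : ℝ) • xiv - (y : ℝ) • etav + etav := by module
    rw [e1, e2, e3, pow_succ]
    ring_nf
  · intro x hx
    simp only [habs]
    exact hup _ (mem_Pset_iff.2 ⟨x, 0, le_rfl, hx, rfl⟩)
  · intro x hx
    have h1 := Finset.mem_filter.1 (hS hx)
    refine ⟨by have := Finset.mem_range.1 h1.1; omega, ?_⟩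
    simp only [habs]
    rw [sub_right_comm]
    exact h1.2
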